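/- (Convergence of stationary points on long time intervals, Theorem 4.4.) Assume there are c₂ > 0 and x₀ ∈ ℝⁿ with V(x) ≤ c₂(1+‖x−x₀‖²) for all x ∈ ℝⁿ. Let K_a, K_b ⊆ ℝⁿ be compact, C > 0, and let b' satisfy a < b' ≤ b and b' − a ≤ √(m/(8c₂)). For each N let γ_1^{(N)},…,γ_N^{(N)} : [a,b] → ℝⁿ be twice continuously differentiable curves, each solving m γ''(t) = −∇V(γ(t)) for all t ∈ [a,b], with γ_i^{(N)}(a) ∈ K_a, γ_i^{(N)}(b) ∈ K_b for all i, and with (1/N)∑_{i=1}^N ∫_a^{b'} [ (m/2)‖γ̇_i^{(N)}(t)‖² − V(γ_i^{(N)}(t)) ] dt ≤ C. Set π^{(N)} := (1/N)∑_{i=1}^N δ_{γ_i^{(N)}}. Then there exist a subsequence of (π^{(N)}) and π ∈ 𝒫(C([a,b];ℝⁿ)) such that the subsequence converges weakly to π; moreover π(Γ_{K_a,K_b}) = 1, where Γ_{K_a,K_b} is the set of twice continuously differentiable curves γ with mγ''(t) = −∇V(γ(t)) for all t, γ(a) ∈ K_a and γ(b) ∈ K_b, and there exists a Borel probability measure η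 on ℝⁿ × ℝⁿ with π = Φ#η. -/

import Mathlib

open MeasureTheory Filter Topology
open scoped ENNReal NNReal

noncomputable section

/-- Euclidean space `ℝⁿ`. -/
abbrev Eu (n : ℕ) := EuclideanSpace ℝ (Fin n)

/-- The space `C([a,b];ℝⁿ)` of continuous curves with the supremum metric. -/
abbrev CPath (a b : ℝ) (n : ℕ) := C(Set.Icc a b, Eu n)

/-- We endow the path space with its Borel σ-algebra. -/
noncomputable instance pathMeasurableSpace (a b : ℝ) (n : ℕ) :
    MeasurableSpace (CPath a b n) := borel _

instance pathBorelSpace (a b : ℝ) (n : ℕ) : BorelSpace (CPath a b n) :=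
  ⟨rfl⟩

/-- Evaluation of a curve at time `t ∈ [a,b]` (junk value `0` outside `[a,b]`). -/
def pev {a b : ℝ} {n : ℕ} (γ : CPath a b n) (t : ℝ) : Eu n :=
  if ht : t ∈ Set.Icc a b then γ ⟨t, ht⟩ else 0

/-- A curve is absolutely continuous if it has a Bochner-integrable derivative `g` with
`γ t = γ s + ∫_s^t g`. -/
def IsACC {a b : ℝ} {n : ℕ} (γ : CPath a b n) : Prop :=
  ∃ g : ℝ → Eu n, IntegrableOn g (Set.Icc a b) ∧
    ∀ s t : Set.Icc a b, γ t = γ s + ∫ u in (s : ℝ)..(t : ℝ), g u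

open Classical in
/-- The action `𝒜(γ) = ∫_a^b L(γ(t), γ̇(t)) dt ∈ (−∞,+∞]`, equal to `+∞` on curves that are
not absolutely continuous (and, by the convention that the integral is `+∞` when the
integrand fails to be integrable -- its negative part being automatically integrable --
also on absolutely continuous curves with non-integrable Lagrangian). -/
def action {n : ℕ} (L : Eu n → Eu n → ℝ) (a b : ℝ) (γ : CPath a b n) : EReal :=
  if h : IsACC γ then
    (if IntegrableOn (fun t => L (pev γ t) (h.choose t)) (Set.Icc a b) then
      (((∫ t in Set.Icc a b, L (pev γ t) (h.choose t)) : ℝ) : EReal)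
    else ⊤)
  else ⊤

/-- Positive part of an extended real, as `ℝ≥0∞`. -/
def epos (x : EReal) : ℝ≥0∞ := if x = ⊤ then ⊤ else ENNReal.ofReal x.toReal

/-- The integral `∫ F dπ ∈ [−∞,+∞]` of an extended-real-valued function, defined as the
difference of the lower integrals of the positive and negative parts. -/
def mint {X : Type*} [MeasurableSpace X] (F : X → EReal) (π : Measure X) : EReal :=
  ((∫⁻ γ, epos (F γ) ∂π : ℝ≥0∞) : EReal) - ((∫⁻ γ, epos (-(F γ)) ∂π : ℝ≥0∞) : EReal)

open Classical in
/-- The constrained functional `𝔸_{μa,μb}(π) = ∫ 𝒜 dπ` if `pr_a#π = μa` and `pr_b#π = μb`,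
and `+∞` otherwise, for a given (extended-real-valued) action functional `F`. -/
def aFun {a b : ℝ} {n : ℕ} (F : CPath a b n → EReal) (μa μb : Measure (Eu n))
    (π : Measure (CPath a b n)) : EReal :=
  if Measure.map (fun γ => pev γ a) π = μa ∧ Measure.map (fun γ => pev γ b) π = μb then
    mint F π
  else ⊤

/-- Weak convergence of a sequence of measures: convergence of the integrals of all bounded
continuous functions. -/
def WeakLim {X : Type*} [TopologicalSpace X] [MeasurableSpace X]
    (πs : ℕ → Measure X) (π : Measure X) : Prop :=
  ∀ φ : BoundedContinuousFunction X ℝ,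
    Tendsto (fun N => ∫ x, φ x ∂(πs N)) atTop (𝓝 (∫ x, φ x ∂π))

/-- The empirical measure `(1/N) ∑_{i=1}^N δ_{x i}`. -/
def emp {X : Type*} [MeasurableSpace X] (N : ℕ) (x : Fin N → X) : Measure X :=
  (N : ℝ≥0∞)⁻¹ • ∑ i : Fin N, Measure.dirac (x i)

/-- The topological support of a measure. -/
def msupp {α : Type*} [TopologicalSpace α] [MeasurableSpace α] (μ : Measure α) : Set α :=
  {x | ∀ U : Set α, IsOpen U → x ∈ U → 0 < μ U}

/-- The set `Γ^min_{K₁,K₂}` of minimizing extremals starting in `K₁` and ending in `K₂`. -/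
def GammaMin {n : ℕ} (L : Eu n → Eu n → ℝ) (a b : ℝ) (K₁ K₂ : Set (Eu n)) :
    Set (CPath a b n) :=
  {γ | IsACC γ ∧ pev γ a ∈ K₁ ∧ pev γ b ∈ K₂ ∧
    ∀ γ' : CPath a b n, IsACC γ' → pev γ' a = pev γ a → pev γ' b = pev γ b →
      action L a b γ ≤ action L a b γ'}

/-- The Lagrangian cost `c(x,y)`: the minimal action among absolutely continuous curves
from `x` to `y`. -/
def cost {n : ℕ} (L : Eu n → Eu n → ℝ) (a b : ℝ) (x y : Eu n) : EReal :=
  ⨅ γ ∈ {γ : CPath a b n | IsACC γ ∧ pev γ a = x ∧ pev γ b = y}, action L a b γ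

/-- The restriction of a continuous curve `ℝ → ℝⁿ` to `[a,b]` as an element of the path
space. -/
def toPath {n : ℕ} (a b : ℝ) (f : ℝ → Eu n) (hf : Continuous f) : CPath a b n :=
  (ContinuousMap.mk f hf).restrict (Set.Icc a b)

/-- `Φ : ℝⁿ × ℝⁿ → C([a,b];ℝⁿ)` is the Euler–Lagrange (Newton) flow map for the Lagrangian
`L(x,v) = (m/2)|v|² − V(x)`: it is continuous and `Φ(x,v)` is a `C²` solution of
`m γ'' = −∇V(γ)` with initial position `x` and initial velocity `v`. -/
def IsNewtonFlow {n : ℕ} (m : ℝ) (V : Eu n → ℝ) (a b : ℝ)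
    (Φ : Eu n × Eu n → CPath a b n) : Prop :=
  Continuous Φ ∧ ∀ x v : Eu n, ∃ f : ℝ → Eu n, ContDiff ℝ 2 f ∧
    (∀ t : Set.Icc a b, Φ (x, v) t = f t) ∧ f a = x ∧ deriv f a = v ∧
    ∀ t ∈ Set.Icc a b, m • deriv (deriv f) t = -gradient V (f t)

/-- The set of `C²` solutions of `m γ'' = −∇V(γ)` starting in `Ka` and ending in `Kb`,
viewed as a subset of the path space. -/
def NewtonSet {n : ℕ} (m : ℝ) (V : Eu n → ℝ) (a b : ℝ) (Ka Kb : Set (Eu n)) :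
    Set (CPath a b n) :=
  {γ | ∃ f : ℝ → Eu n, ContDiff ℝ 2 f ∧ (∀ t : Set.Icc a b, γ t = f t) ∧
    (∀ t ∈ Set.Icc a b, m • deriv (deriv f) t = -gradient V (f t)) ∧
    f a ∈ Ka ∧ f b ∈ Kb}

/-- `γ` is piecewise affine subordinate to the partition `a = τ₀ < … < τ_l = b`. -/
def PiecewiseAffine {n : ℕ} (a b : ℝ) (τ : ℕ → ℝ) (l : ℕ) (γ : CPath a b n) : Prop :=
  ∀ j < l, ∀ t : Set.Icc a b, (t : ℝ) ∈ Set.Icc (τ j) (τ (j + 1)) →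
    γ t = pev γ (τ j) + (((t : ℝ) - τ j) / (τ (j + 1) - τ j)) •
      (pev γ (τ (j + 1)) - pev γ (τ j))

/-- `IsPartition a b τ l h`: `a = τ₀ < τ₁ < … < τ_l = b` is a partition of `[a,b]` of mesh
at most `h`. -/
def IsPartition (a b : ℝ) (τ : ℕ → ℝ) (l : ℕ) (h : ℝ) : Prop :=
  1 ≤ l ∧ τ 0 = a ∧ τ l = b ∧ (∀ j < l, τ j < τ (j + 1)) ∧
    ∀ j < l, τ (j + 1) - τ j ≤ h

/-- The midpoint-rule discrete action, as a (real-valued) sum over the first `l` intervals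
of the partition. -/
def dActionSum {n : ℕ} (m : ℝ) (V : Eu n → ℝ) {a b : ℝ} (τ : ℕ → ℝ) (l : ℕ)
    (γ : CPath a b n) : ℝ :=
  ∑ j ∈ Finset.range l,
    (m / 2 * ‖pev γ (τ (j + 1)) - pev γ (τ j)‖ ^ 2 / (τ (j + 1) - τ j) -
      V ((2 : ℝ)⁻¹ • (pev γ (τ (j + 1)) + pev γ (τ j))) * (τ (j + 1) - τ j))

open Classical in
/-- The discrete action `𝒜^{[h]}`: the midpoint-rule discrete action for piecewise affine
curves subordinate to the partition, `+∞` otherwise. -/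
def dAction {n : ℕ} (m : ℝ) (V : Eu n → ℝ) (a b : ℝ) (τ : ℕ → ℝ) (l : ℕ)
    (γ : CPath a b n) : EReal :=
  if PiecewiseAffine a b τ l γ then ((dActionSum m V τ l γ : ℝ) : EReal) else ⊤

/-- The discrete Euler–Lagrange equations for a piecewise affine curve subordinate to the
partition `a = τ₀ < … < τ_l = b`. -/
def DiscreteEL {n : ℕ} (m : ℝ) (V : Eu n → ℝ) {a b : ℝ} (τ : ℕ → ℝ) (l : ℕ)
    (γ : CPath a b n) : Prop :=
  ∀ j, 1 ≤ j → j < l →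
    m • ((τ j - τ (j - 1))⁻¹ • (pev γ (τ j) - pev γ (τ (j - 1)))) -
      m • ((τ (j + 1) - τ j)⁻¹ • (pev γ (τ (j + 1)) - pev γ (τ j))) =
    ((τ j - τ (j - 1)) / 2) • gradient V ((2 : ℝ)⁻¹ • (pev γ (τ (j - 1)) + pev γ (τ j))) +
      ((τ (j + 1) - τ j) / 2) • gradient V ((2 : ℝ)⁻¹ • (pev γ (τ j) + pev γ (τ (j + 1))))

end

section NewtonCurves

variable {E : Type*} [NormedAddCommGroup E] [NormedSpace ℝ E]

lemma hasDerivAt_deriv_of_contDiff_two {f : ℝ → E} (hf : ContDiff ℝ 2 f) (t : ℝ) :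
    HasDerivAt f (deriv f t) t ∧ HasDerivAt (deriv f) (deriv (deriv f) t) t := by
  have h2 : ContDiff ℝ (1 + 1) f := by simpa [one_add_one_eq_two] using hf
  have h1 : ContDiff ℝ 1 (deriv f) := (contDiff_succ_iff_deriv.1 h2).2.2
  exact ⟨(hf.differentiable (by norm_num) t).hasDerivAt,
    (h1.differentiable (by norm_num) t).hasDerivAt⟩

/-- Uniqueness for the second-order equation `f'' = A(f)` with `A` of class `C¹`. -/
lemma eqOn_of_secondOrder_ode {A : E → E} (hA : ContDiff ℝ 1 A) {a b : ℝ} {f g : ℝ → E}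
    (hf : ContDiff ℝ 2 f) (hg : ContDiff ℝ 2 g)
    (hfA : ∀ t ∈ Set.Icc a b, deriv (deriv f) t = A (f t))
    (hgA : ∀ t ∈ Set.Icc a b, deriv (deriv g) t = A (g t))
    (h0 : f a = g a) (h1 : deriv f a = deriv g a) : Set.EqOn f g (Set.Icc a b) := by
  have hcurve : ∀ {h : ℝ → E}, ContDiff ℝ 2 h → Continuous fun t => (h t, deriv h t) :=
    fun hh => hh.continuous.prodMk (hh.continuous_deriv (by norm_num))
  set s : Set (E × E) := (fun t => (f t, deriv f t)) '' Set.Icc a b ∪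
    (fun t => (g t, deriv g t)) '' Set.Icc a b
  have hsc : IsCompact s :=
    (isCompact_Icc.image (hcurve hf)).union (isCompact_Icc.image (hcurve hg))
  have hv : ContDiff ℝ 1 fun p : E × E => (p.2, A p.1) := by fun_prop
  obtain ⟨K, hK⟩ := LocallyLipschitzOn.exists_lipschitzOnWith_of_compact hsc
    (LocallyLipschitz.locallyLipschitzOn hv.locallyLipschitz)
  have hderiv : ∀ {h : ℝ → E}, ContDiff ℝ 2 h →
      (∀ t ∈ Set.Icc a b, deriv (deriv h) t = A (h t)) → ∀ t ∈ Set.Ico a b,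
      HasDerivWithinAt (fun t => (h t, deriv h t)) (deriv h t, A (h t)) (Set.Ici t) t := by
    intro h hh hhA t ht
    rw [← hhA t (Set.Ico_subset_Icc_self ht)]
    obtain ⟨d1, d2⟩ := hasDerivAt_deriv_of_contDiff_two hh t
    exact (d1.prodMk d2).hasDerivWithinAt
  have key := ODE_solution_unique_of_mem_Icc_right (v := fun _ p => (p.2, A p.1))
    (s := fun _ => s) (fun _ _ => hK) (hcurve hf).continuousOn (hderiv hf hfA)
    (fun t ht => Or.inl ⟨t, Set.Ico_subset_Icc_self ht, rfl⟩) (hcurve hg).continuousOn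
    (hderiv hg hgA) (fun t ht => Or.inr ⟨t, Set.Ico_subset_Icc_self ht, rfl⟩)
    (by simp [h0, h1])
  exact fun t ht => congrArg Prod.fst (key ht)

/-- Cauchy–Schwarz: `(∫_a^b g)² ≤ (b - a) ∫_a^b g²`. -/
lemma sq_intervalIntegral_le {g : ℝ → ℝ} (hg : Continuous g) {a b : ℝ} (hab : a ≤ b) :
    (∫ t in a..b, g t) ^ 2 ≤ (b - a) * ∫ t in a..b, g t ^ 2 := by
  rcases hab.eq_or_lt with rfl | hlt
  · simp
  set I := ∫ t in a..b, g t
  have hT : 0 < b - a := sub_pos.2 hlt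
  have h0 : 0 ≤ ∫ t in a..b, ((b - a) * g t - I) ^ 2 :=
    intervalIntegral.integral_nonneg hab fun t _ => sq_nonneg _
  have h1 : ∫ t in a..b, ((b - a) * g t - I) ^ 2 =
      (b - a) ^ 2 * (∫ t in a..b, g t ^ 2) - 2 * (b - a) * I * I + (b - a) * I ^ 2 := by
    have : (fun t => ((b - a) * g t - I) ^ 2) =
        fun t => (b - a) ^ 2 * g t ^ 2 - 2 * (b - a) * I * g t + I ^ 2 := by
      ext t; ring
    rw [this, intervalIntegral.integral_add, intervalIntegral.integral_sub,
      intervalIntegral.integral_const_mul, intervalIntegral.integral_const_mul,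
      intervalIntegral.integral_const, smul_eq_mul]
    all_goals exact Continuous.intervalIntegrable (by fun_prop) _ _
  rw [h1] at h0
  have h2 : 0 ≤ (b - a) * ((b - a) * (∫ t in a..b, g t ^ 2) - I ^ 2) := by linarith
  linarith [nonneg_of_mul_nonneg_right h2 hT]

lemma norm_sub_sq_le_mul_kineticEnergy [CompleteSpace E] {f : ℝ → E} (hf : ContDiff ℝ 1 f)
    {a b t : ℝ} (ht : t ∈ Set.Icc a b) :
    ‖f t - f a‖ ^ 2 ≤ (b - a) * ∫ s in a..b, ‖deriv f s‖ ^ 2 := by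
  have hc : Continuous (deriv f) := hf.continuous_deriv le_rfl
  have hle : ‖f t - f a‖ ≤ ∫ s in a..t, ‖deriv f s‖ := by
    rw [← intervalIntegral.integral_deriv_eq_sub
      (fun s _ => hf.differentiable (by norm_num) s) (hc.intervalIntegrable _ _)]
    exact intervalIntegral.norm_integral_le_integral_norm ht.1
  have hmono : ∫ s in a..t, ‖deriv f s‖ ≤ ∫ s in a..b, ‖deriv f s‖ :=
    intervalIntegral.integral_mono_interval le_rfl ht.1 ht.2
      (Eventually.of_forall fun s => norm_nonneg _) (hc.norm.intervalIntegrable _ _)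
  calc ‖f t - f a‖ ^ 2 ≤ (∫ s in a..b, ‖deriv f s‖) ^ 2 := by
        gcongr; exact hle.trans hmono
    _ ≤ _ := sq_intervalIntegral_le hc.norm (ht.1.trans ht.2)

/-- On an interval of length at most `√(m/(8c))`, the action controls the kinetic energy. -/
lemma kineticEnergy_le_action [CompleteSpace E] {V : E → ℝ} (hV : Continuous V) {m c R : ℝ}
    (hc : 0 < c) {x₀ : E} (hVc : ∀ x, V x ≤ c * (1 + ‖x - x₀‖ ^ 2)) {a b : ℝ}
    (hab : a < b) (hT : b - a ≤ Real.sqrt (m / (8 * c))) {f : ℝ → E} (hf : ContDiff ℝ 1 f)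
    (hR : ‖f a - x₀‖ ≤ R) :
    m / 4 * ∫ t in a..b, ‖deriv f t‖ ^ 2 ≤
      (∫ t in a..b, (m / 2 * ‖deriv f t‖ ^ 2 - V (f t))) + c * (b - a) * (1 + 2 * R ^ 2) := by
  have hfc := hf.continuous
  have hdc : Continuous (deriv f) := hf.continuous_deriv le_rfl
  set K := ∫ t in a..b, ‖deriv f t‖ ^ 2
  have hK0 : 0 ≤ K := intervalIntegral.integral_nonneg hab.le fun t _ => by positivity
  have hT2 : c * (b - a) ^ 2 ≤ m / 8 := by
    have h := (Real.le_sqrt' (sub_pos.2 hab)).1 hT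
    rw [le_div_iff₀ (by positivity)] at h
    linarith
  have hVt : ∀ t ∈ Set.Icc a b, V (f t) ≤ c * (1 + 2 * R ^ 2 + 2 * ((b - a) * K)) := by
    intro t ht
    refine (hVc _).trans ?_
    have h1 := norm_sub_sq_le_mul_kineticEnergy hf ht
    have h2 : ‖f t - x₀‖ ≤ ‖f t - f a‖ + ‖f a - x₀‖ := norm_sub_le_norm_sub_add_norm_sub ..
    have h3 : ‖f t - x₀‖ ^ 2 ≤ 2 * ‖f t - f a‖ ^ 2 + 2 * R ^ 2 := by
      have : ‖f t - x₀‖ ^ 2 ≤ (‖f t - f a‖ + R) ^ 2 := by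
        gcongr; linarith
      nlinarith [sq_nonneg (‖f t - f a‖ - R)]
    refine mul_le_mul_of_nonneg_left ?_ hc.le
    linarith
  have hVi : ∫ t in a..b, V (f t) ≤ (b - a) * (c * (1 + 2 * R ^ 2 + 2 * ((b - a) * K))) := by
    have := intervalIntegral.integral_mono_on hab.le
      ((hV.comp hfc).intervalIntegrable (μ := volume) a b) intervalIntegrable_const hVt
    rwa [intervalIntegral.integral_const, smul_eq_mul] at this
  rw [intervalIntegral.integral_sub (Continuous.intervalIntegrable (by fun_prop) _ _)
    (Continuous.intervalIntegrable (by fun_prop) _ _), intervalIntegral.integral_const_mul]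
  have := mul_le_mul_of_nonneg_right hT2 hK0
  linarith

/-- A bound on the initial position and the kinetic energy of a solution of `f'' = A(f)`
bounds its initial velocity. -/
lemma exists_bound_initial_velocity [ProperSpace E] {A : E → E} (hA : Continuous A)
    {a b : ℝ} (hab : a < b) (x₀ : E) (R K : ℝ) :
    ∃ W : ℝ, ∀ f : ℝ → E, ContDiff ℝ 2 f →
      (∀ t ∈ Set.Icc a b, deriv (deriv f) t = A (f t)) → ‖f a - x₀‖ ≤ R →
      ∫ t in a..b, ‖deriv f t‖ ^ 2 ≤ K → ‖deriv f a‖ ≤ W := by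
  obtain ⟨G, hG⟩ := (isCompact_closedBall x₀
    (R + Real.sqrt ((b - a) * K))).exists_bound_of_continuousOn hA.continuousOn
  refine ⟨Real.sqrt (2 * K / (b - a) + 2 * (G * (b - a)) ^ 2), fun f hf hfA hfR hfK => ?_⟩
  have hT : 0 < b - a := sub_pos.2 hab
  have hdc : Continuous (deriv f) := hf.continuous_deriv (by norm_num)
  have hball : ∀ t ∈ Set.Icc a b, f t ∈ Metric.closedBall x₀ (R + Real.sqrt ((b - a) * K)) := by
    intro t ht
    have h1 : ‖f t - f a‖ ≤ Real.sqrt ((b - a) * K) := by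
      apply Real.le_sqrt_of_sq_le
      refine (norm_sub_sq_le_mul_kineticEnergy (hf.of_le (by norm_num)) ht).trans ?_
      gcongr
    rw [mem_closedBall_iff_norm]
    linarith [norm_sub_le_norm_sub_add_norm_sub (f t) (f a) x₀]
  have hG0 : 0 ≤ G := (norm_nonneg _).trans (hG _ (hball a (Set.left_mem_Icc.2 hab.le)))
  have hvel : ∀ t ∈ Set.Icc a b, ‖deriv f a‖ ^ 2 ≤ 2 * ‖deriv f t‖ ^ 2 + 2 * (G * (b - a)) ^ 2 := by
    intro t ht
    have h1 : ‖deriv f t - deriv f a‖ ≤ G * (t - a) :=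
      norm_image_sub_le_of_norm_deriv_le_segment'
        (fun s _ => (hasDerivAt_deriv_of_contDiff_two hf s).2.hasDerivWithinAt)
        (fun s hs => by
          rw [hfA s (Set.Ico_subset_Icc_self hs)]
          exact hG _ (hball s (Set.Ico_subset_Icc_self hs))) t ht
    have h2 : G * (t - a) ≤ G * (b - a) := by gcongr; exact ht.2
    have h3 : ‖deriv f a‖ ≤ ‖deriv f t‖ + G * (b - a) := by
      linarith [norm_sub_norm_le (deriv f a) (deriv f t), norm_sub_rev (deriv f a) (deriv f t)]
    calc ‖deriv f a‖ ^ 2 ≤ (‖deriv f t‖ + G * (b - a)) ^ 2 := by gcongr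
      _ ≤ _ := by nlinarith [sq_nonneg (‖deriv f t‖ - G * (b - a))]
  have hint := intervalIntegral.integral_mono_on (μ := volume) hab.le intervalIntegrable_const
    (Continuous.intervalIntegrable (by fun_prop) _ _) hvel
  rw [intervalIntegral.integral_add (Continuous.intervalIntegrable (by fun_prop) _ _)
    intervalIntegrable_const, intervalIntegral.integral_const_mul] at hint
  simp only [intervalIntegral.integral_const, smul_eq_mul] at hint
  apply Real.le_sqrt_of_sq_le
  rw [← sub_le_iff_le_add, le_div_iff₀ hT]
  linarith

end NewtonCurves

section EmpiricalMeasures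

variable {X : Type*} [MeasurableSpace X]

lemma emp_apply {N : ℕ} (x : Fin N → X) {s : Set X} (hs : MeasurableSet s) :
    emp N x s = ENNReal.ofReal ((N : ℝ)⁻¹ * ∑ i, s.indicator 1 (x i)) := by
  have hsum : ∑ i, s.indicator (1 : X → ℝ≥0∞) (x i) =
      ENNReal.ofReal (∑ i, s.indicator (1 : X → ℝ) (x i)) := by
    rw [ENNReal.ofReal_sum_of_nonneg fun i _ => Set.indicator_nonneg (by simp) _]
    refine Finset.sum_congr rfl fun i _ => ?_
    by_cases h : x i ∈ s <;> simp [h]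
  rcases Nat.eq_zero_or_pos N with rfl | hN
  · simp [emp]
  · have hN' : (0 : ℝ) < N := Nat.cast_pos.2 hN
    simp only [emp, Measure.smul_apply, Measure.finsetSum_apply, smul_eq_mul,
      Measure.dirac_apply' _ hs, hsum]
    rw [ENNReal.ofReal_mul (by positivity), ENNReal.ofReal_inv_of_pos hN', ENNReal.ofReal_natCast]

lemma emp_eq_one {N : ℕ} (hN : N ≠ 0) {x : Fin N → X} {s : Set X} (hs : MeasurableSet s)
    (hx : ∀ i, x i ∈ s) : emp N x s = 1 := by
  rw [emp_apply x hs]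
  simp [hx, hN]

lemma isProbabilityMeasure_emp {N : ℕ} (hN : N ≠ 0) (x : Fin N → X) :
    IsProbabilityMeasure (emp N x) :=
  ⟨emp_eq_one hN MeasurableSet.univ fun _ => trivial⟩

lemma map_emp {Y : Type*} [MeasurableSpace Y] {Φ : X → Y} (hΦ : Measurable Φ) {N : ℕ}
    (x : Fin N → X) : (emp N x).map Φ = emp N (fun i => Φ (x i)) := by
  rw [emp, emp, ← Measure.mapₗ_apply_of_measurable hΦ, LinearMap.map_smul_of_tower, map_sum]
  simp [Measure.mapₗ_apply_of_measurable hΦ, Measure.map_dirac' hΦ]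

/-- Markov's inequality for empirical measures. -/
lemma emp_le_of_average_le {N : ℕ} (x : Fin N → X) {s : Set X} (hs : MeasurableSet s)
    {e : Fin N → ℝ} {M r : ℝ} (hr : 0 < r) (he : ∀ i, 0 ≤ e i) (hse : ∀ i, x i ∈ s → r ≤ e i)
    (hM : (N : ℝ)⁻¹ * ∑ i, e i ≤ M) : emp N x s ≤ ENNReal.ofReal (M / r) := by
  rw [emp_apply x hs]
  apply ENNReal.ofReal_le_ofReal
  rw [le_div_iff₀ hr, mul_assoc, Finset.sum_mul]
  refine le_trans ?_ hM
  gcongr with i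
  by_cases h : x i ∈ s
  · simpa [h] using hse i h
  · simpa [h] using he i

end EmpiricalMeasures

/-- Sequential form of Prokhorov's theorem. -/
lemma exists_subseq_tendsto_of_isTightMeasureSet {X : Type*} [TopologicalSpace X]
    [TopologicalSpace.MetrizableSpace X] [TopologicalSpace.SeparableSpace X]
    [MeasurableSpace X] [BorelSpace X] (μ : ℕ → ProbabilityMeasure X)
    (hμ : IsTightMeasureSet (Set.range fun k => (μ k : Measure X))) :
    ∃ φ : ℕ → ℕ, StrictMono φ ∧ ∃ ν : ProbabilityMeasure X,
      Tendsto (fun k => μ (φ k)) atTop (𝓝 ν) := by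
  have hc : IsCompact (closure (Set.range μ)) := by
    apply isCompact_closure_of_isTightMeasureSet
    convert hμ using 1
    ext; simp
  obtain ⟨ν, -, φ, hφ, hlim⟩ :=
    hc.isSeqCompact fun k => subset_closure (Set.mem_range_self (f := μ) k)
  exact ⟨φ, hφ, ν, hlim⟩

lemma contDiff_gradient {E : Type*} [NormedAddCommGroup E] [InnerProductSpace ℝ E]
    [CompleteSpace E] {V : E → ℝ} (hV : ContDiff ℝ 2 V) : ContDiff ℝ 1 (gradient V) :=
  (InnerProductSpace.toDual ℝ E).symm.contDiff.comp
    (hV.fderiv_right (m := 1) (by norm_num [one_add_one_eq_two]))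

/-- **Convergence of stationary points on long time intervals (Theorem 4.4).**
Assume `V(x) ≤ c₂(1+‖x−x₀‖²)`. If `γ_1^{(N)},…,γ_N^{(N)}` are `C²` solutions of
`mγ'' = −∇V(γ)` on `[a,b]` starting in `K_a`, ending in `K_b`, whose average action on a
short initial time interval `[a,b']` (with `b' − a ≤ √(m/(8c₂))`) is bounded by `C`, then
the empirical measures admit a weakly convergent subsequence whose limit `π` is
concentrated on the extremals from `K_a` to `K_b` and is the pushforward of a probability
measure `η` under the Euler–Lagrange flow map `Φ`. -/
theorem convergence_of_stationary_points_long_time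
    {n : ℕ} (hn : 1 ≤ n) {a b : ℝ} (hab : a < b)
    (m : ℝ) (hm : 0 < m) (V : Eu n → ℝ) (hV1 : ContDiff ℝ (⊤ : ℕ∞) V)
    (c₂ : ℝ) (hc₂ : 0 < c₂) (x₀ : Eu n)
    (hV2 : ∀ x : Eu n, V x ≤ c₂ * (1 + ‖x - x₀‖ ^ 2))
    (Φ : Eu n × Eu n → CPath a b n) (hΦ : IsNewtonFlow m V a b Φ)
    (Ka Kb : Set (Eu n)) (hKa : IsCompact Ka) (hKb : IsCompact Kb)
    (C : ℝ) (hC : 0 < C)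
    (b' : ℝ) (hb'1 : a < b') (hb'2 : b' ≤ b) (hb'3 : b' - a ≤ Real.sqrt (m / (8 * c₂)))
    (γ : (N : ℕ) → Fin N → ℝ → Eu n)
    (hγC2 : ∀ N i, ContDiff ℝ 2 (γ N i))
    (hEL : ∀ N i, ∀ t ∈ Set.Icc a b,
      m • deriv (deriv (γ N i)) t = -gradient V (γ N i t))
    (hstart : ∀ N i, γ N i a ∈ Ka) (hend : ∀ N i, γ N i b ∈ Kb)
    (hact : ∀ N : ℕ,
      ((N : ℝ))⁻¹ * ∑ i : Fin N,
          (∫ t in a..b', (m / 2 * ‖deriv (γ N i) t‖ ^ 2 - V (γ N i t))) ≤ C) :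
    ∃ φ : ℕ → ℕ, StrictMono φ ∧ ∃ π : Measure (CPath a b n), IsProbabilityMeasure π ∧
      WeakLim
        (fun k => emp (φ k) (fun i => toPath a b (γ (φ k) i) (hγC2 (φ k) i).continuous))
        π ∧
      π (NewtonSet m V a b Ka Kb) = 1 ∧
      ∃ η : Measure (Eu n × Eu n), IsProbabilityMeasure η ∧ π = Measure.map Φ η := by
  have hab' : Set.Icc a b' ⊆ Set.Icc a b := Set.Icc_subset_Icc_right hb'2
  set A : Eu n → Eu n := fun x => m⁻¹ • -gradient V x with hA
  have hA1 : ContDiff ℝ 1 A :=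
    (contDiff_gradient (hV1.of_le (WithTop.coe_le_coe.2 le_top))).neg.const_smul _
  have hNewton : ∀ {f : ℝ → Eu n} {t : ℝ}, m • deriv (deriv f) t = -gradient V (f t) →
      deriv (deriv f) t = A (f t) := fun h => by
    simp only [hA, ← h, inv_smul_smul₀ hm.ne']
  obtain ⟨R, hR⟩ := hKa.exists_bound_of_continuousOn
    (f := fun x => x - x₀) (by fun_prop)
  set D := c₂ * (b' - a) * (1 + 2 * R ^ 2)
  have hD0 : 0 ≤ D := by
    have := sub_pos.2 hb'1
    positivity
  set M := 4 / m * (C + D)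
  have hM : 0 < M := by positivity
  let kin : (N : ℕ) → Fin N → ℝ := fun N i => ∫ t in a..b', ‖deriv (γ N i) t‖ ^ 2
  have hkin0 : ∀ N i, 0 ≤ kin N i := fun N i =>
    intervalIntegral.integral_nonneg hb'1.le fun t _ => by positivity
  have hkinM : ∀ N : ℕ, (N : ℝ)⁻¹ * ∑ i, kin N i ≤ M := by
    intro N
    have h1 : ∀ i, kin N i ≤ 4 / m *
        ((∫ t in a..b', (m / 2 * ‖deriv (γ N i) t‖ ^ 2 - V (γ N i t))) + D) := by
      intro i
      rw [← div_le_iff₀' (by positivity), div_div_eq_mul_div, mul_comm, mul_div_right_comm]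
      exact kineticEnergy_le_action hV1.continuous hc₂ hV2 hb'1 hb'3
        ((hγC2 N i).of_le (by norm_num)) (hR _ (hstart N i))
    calc (N : ℝ)⁻¹ * ∑ i, kin N i
        ≤ (N : ℝ)⁻¹ * ∑ i, 4 / m *
            ((∫ t in a..b', (m / 2 * ‖deriv (γ N i) t‖ ^ 2 - V (γ N i t))) + D) := by
          gcongr with i
          exact h1 i
      _ = 4 / m * ((N : ℝ)⁻¹ * ∑ i,
            (∫ t in a..b', (m / 2 * ‖deriv (γ N i) t‖ ^ 2 - V (γ N i t)))) +
              4 / m * ((N : ℝ)⁻¹ * N * D) := by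
          rw [← Finset.mul_sum, Finset.sum_add_distrib]
          simp
          ring
      _ ≤ M := by
          have h2 : (N : ℝ)⁻¹ * N * D ≤ D :=
            mul_le_of_le_one_left hD0 inv_mul_le_one
          rw [← mul_add]
          exact mul_le_mul_of_nonneg_left (add_le_add (hact N) h2) (by positivity)
  let x : (N : ℕ) → Fin N → Eu n × Eu n := fun N i => (γ N i a, deriv (γ N i) a)
  have hpath : ∀ N i, toPath a b (γ N i) (hγC2 N i).continuous = Φ (x N i) := by
    intro N i
    obtain ⟨f, hf, hΦf, hfa, hfv, hfN⟩ := hΦ.2 (γ N i a) (deriv (γ N i) a)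
    ext1 t
    rw [hΦf t]
    exact eqOn_of_secondOrder_ode hA1 (hγC2 N i) hf (fun t ht => hNewton (hEL N i t ht))
      (fun t ht => hNewton (hfN t ht)) hfa.symm hfv.symm t.2
  have hΦm : Measurable Φ := hΦ.1.measurable
  have hemp : ∀ N, emp N (fun i => toPath a b (γ N i) (hγC2 N i).continuous) =
      (emp N (x N)).map Φ := by
    intro N
    simp only [hpath, map_emp hΦm]
  let μ : ℕ → ProbabilityMeasure (Eu n × Eu n) := fun k =>
    ⟨emp (k + 1) (x (k + 1)), isProbabilityMeasure_emp k.succ_ne_zero _⟩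
  have htight : IsTightMeasureSet (Set.range fun k => (μ k : Measure (Eu n × Eu n))) := by
    rw [isTightMeasureSet_iff_exists_isCompact_measure_compl_le]
    intro ε hε
    rcases eq_or_ne ε ⊤ with rfl | hε'
    · exact ⟨∅, isCompact_empty, fun _ _ => le_top⟩
    have hε0 : 0 < ε.toReal := ENNReal.toReal_pos hε.ne' hε'
    obtain ⟨W, hW⟩ := exists_bound_initial_velocity hA1.continuous hb'1 x₀ R (M / ε.toReal)
    have hc := hKa.prod (isCompact_closedBall (0 : Eu n) W)
    refine ⟨_, hc, ?_⟩
    rintro _ ⟨k, rfl⟩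
    refine (emp_le_of_average_le (x (k + 1)) hc.measurableSet.compl (r := M / ε.toReal)
      (by positivity) (hkin0 _) (fun i hi => ?_) (hkinM (k + 1))).trans_eq ?_
    · by_contra! hlt
      refine hi ⟨hstart _ i, mem_closedBall_zero_iff.2 ?_⟩
      exact hW _ (hγC2 _ i) (fun t ht => hNewton (hEL _ i t (hab' ht))) (hR _ (hstart _ i)) hlt.le
    · rw [div_div_cancel₀ hM.ne', ENNReal.ofReal_toReal hε']
  obtain ⟨φ, hφ, η, hη⟩ := exists_subseq_tendsto_of_isTightMeasureSet μ htight
  have hprob : IsProbabilityMeasure ((η : Measure (Eu n × Eu n)).map Φ) :=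
    Measure.isProbabilityMeasure_map hΦm.aemeasurable
  refine ⟨fun k => φ k + 1, fun i j hij => Nat.succ_lt_succ (hφ hij), _, hprob, ?_, ?_,
    η, inferInstance, rfl⟩
  · intro g
    have h := ProbabilityMeasure.tendsto_iff_forall_integral_tendsto.1 hη
      (g.compContinuous ⟨Φ, hΦ.1⟩)
    simp only [hemp]
    simp_rw [integral_map hΦm.aemeasurable g.continuous.aestronglyMeasurable]
    exact h
  · have hbI : b ∈ Set.Icc a b := Set.right_mem_Icc.2 hab.le
    set F : Set (Eu n × Eu n) := {p | p.1 ∈ Ka ∧ Φ p ⟨b, hbI⟩ ∈ Kb}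
    have hFc : IsClosed F := (hKa.isClosed.preimage continuous_fst).inter
      (hKb.isClosed.preimage ((continuous_eval_const _).comp hΦ.1))
    have hFsub : F ⊆ Φ ⁻¹' NewtonSet m V a b Ka Kb := by
      rintro ⟨y, v⟩ ⟨hy, hb⟩
      obtain ⟨f, hf, hΦf, hfa, -, hfN⟩ := hΦ.2 y v
      exact ⟨f, hf, hΦf, hfN, hfa ▸ hy, hΦf ⟨b, hbI⟩ ▸ hb⟩
    have hμF : ∀ k, (μ k : Measure (Eu n × Eu n)) F = 1 := fun k =>
      emp_eq_one k.succ_ne_zero hFc.measurableSet fun i => ⟨hstart _ i, by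
        rw [← hpath]
        exact hend _ i⟩
    have hlim := ProbabilityMeasure.limsup_measure_closed_le_of_tendsto hη hFc
    simp only [hμF, limsup_const] at hlim
    exact le_antisymm prob_le_one
      ((hlim.trans (measure_mono hFsub)).trans (Measure.le_map_apply hΦm.aemeasurable _))
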